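/- Let l ≥ 3 be an odd integer and ξ ∈ ℂ a primitive l-th root of unity. Then every polynomial f ∈ ℂ[u] with f(0) = 1 admits a unique factorization f(u) = (∏_{k=1}^{m₀} f_{a_k, r_k}(u)) · (∏_{k=1}^{m₁} (1 − b_k u^l)), where m₀, m₁ ∈ ℤ_{≥0}, a_k, b_k ∈ ℂ^×, 0 < r_k < l, and a_k/a_j ≠ ξ^{±(r_k + r_j − 2p)} for all k ≠ j and 0 ≤ p < min{r_k, r_j}. (Uniqueness is up to permutation of the factors within each product.) -/

import Mathlib

open Polynomial

/-- The `q`-string polynomial `f_{a,r}(u) = ∏_{j=0}^{r-1} (1 - a ξ^{r-1-2j} u)`. -/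
noncomputable def qString (ξ a : ℂ) (r : ℕ) : Polynomial ℂ :=
  ∏ j ∈ Finset.range r, (1 - C (a * ξ ^ ((r : ℤ) - 1 - 2 * j)) * X)

/-- The non-resonance condition: for all `k ≠ j` and `0 ≤ p < min (r_k) (r_j)`,
`a_k / a_j ≠ ξ^{±(r_k + r_j - 2p)}`. -/
def NonResonant (ξ : ℂ) {m : ℕ} (a : Fin m → ℂ) (r : Fin m → ℕ) : Prop :=
  ∀ k j, k ≠ j → ∀ p : ℕ, p < min (r k) (r j) →
    a k / a j ≠ ξ ^ ((r k : ℤ) + (r j : ℤ) - 2 * p) ∧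
    a k / a j ≠ ξ ^ (-((r k : ℤ) + (r j : ℤ) - 2 * p))

def SCov (ξ : ℂ) (A : ℂ × ℕ) (z : ℂ) : Prop :=
  ∃ i : ℕ, i < A.2 ∧ z = A.1 * ξ ^ ((A.2 : ℤ) - 1 - 2 * i)

def SRel (ξ : ℂ) (A B : ℂ × ℕ) : Prop :=
  ∀ p : ℕ, p < min A.2 B.2 →
    A.1 / B.1 ≠ ξ ^ ((A.2 : ℤ) + (B.2 : ℤ) - 2 * p) ∧
    A.1 / B.1 ≠ ξ ^ (-((A.2 : ℤ) + (B.2 : ℤ) - 2 * p))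

theorem SRel.symm' {ξ : ℂ} {A B : ℂ × ℕ} (h : SRel ξ A B) : SRel ξ B A := by
  intro p hp
  obtain ⟨h1, h2⟩ := h p (by rwa [min_comm])
  have e : A.1 / B.1 = (B.1 / A.1)⁻¹ := by rw [inv_div]
  rw [e] at h1 h2
  constructor
  · intro h
    apply h2
    rw [h, ← zpow_neg]
    congr 1; ring
  · intro h
    apply h1
    rw [h, ← zpow_neg]
    congr 1; ring

theorem zshift {ξ a b : ℂ} (h0 : ξ ≠ 0) {m n : ℤ} (h : a * ξ ^ m = b * ξ ^ n) (k m' n' : ℤ)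
    (hm : m' = m + k) (hn : n' = n + k) : a * ξ ^ m' = b * ξ ^ n' := by
  subst hm hn
  rw [zpow_add₀ h0, zpow_add₀ h0, ← mul_assoc, ← mul_assoc, h]

theorem zdiv {ξ a b : ℂ} (h0 : ξ ≠ 0) (hb : b ≠ 0) {m n : ℤ} (h : a * ξ ^ m = b * ξ ^ n) (k : ℤ)
    (hk : k = n - m) : a / b = ξ ^ k := by
  subst hk
  rw [div_eq_iff hb, zpow_sub₀ h0]
  have := zpow_ne_zero m h0
  field_simp
  rw [h]; ring

theorem zmul {ξ a b : ℂ} (h0 : ξ ≠ 0) (hb : b ≠ 0) {k : ℤ} (h : a / b = ξ ^ k) (m n : ℤ)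
    (hk : k = n - m) : a * ξ ^ m = b * ξ ^ n := by
  subst hk
  rw [div_eq_iff hb] at h
  rw [h, zpow_sub₀ h0]
  have := zpow_ne_zero m h0
  field_simp

/-- `SRel` gives : `B` cannot cover the upper neighbour -/
theorem srel_up {ξ : ℂ} (h0 : ξ ≠ 0) {A B : ℂ × ℕ} (hA : A.1 ≠ 0) (h : SRel ξ A B)
    (hr : B.2 ≤ A.2) : ¬ SCov ξ B (A.1 * ξ ^ ((A.2 : ℤ) + 1)) := by
  rintro ⟨i, hi, e⟩
  have := (h.symm' (B.2 - 1 - i) (by simp; omega)).1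
  apply this
  apply zdiv h0 hA e.symm
  have : ((B.2 - 1 - i : ℕ) : ℤ) = B.2 - 1 - i := by omega
  rw [this]; ring

theorem srel_down {ξ : ℂ} (h0 : ξ ≠ 0) {A B : ℂ × ℕ} (hA : A.1 ≠ 0) (h : SRel ξ A B)
    {i : ℕ} (hi : i < B.2) (hr : i < A.2) :
    A.1 * ξ ^ (-(A.2 : ℤ) - 1) ≠ B.1 * ξ ^ ((B.2 : ℤ) - 1 - 2 * i) := by
  intro e
  have := (h.symm' i (by simp; omega)).2
  apply this
  apply zdiv h0 hA e.symm
  ring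

theorem srel_of {ξ : ℂ} (h0 : ξ ≠ 0) {A B : ℂ × ℕ} (hA : A.1 ≠ 0)
    (hu : ¬ SCov ξ B (A.1 * ξ ^ ((A.2 : ℤ) + 1))) (hd : ¬ SCov ξ B (A.1 * ξ ^ (-(A.2 : ℤ) - 1))) :
    SRel ξ A B := by
  apply SRel.symm'
  intro p hp
  simp only [lt_min_iff] at hp
  constructor
  · intro h
    apply hu
    refine ⟨B.2 - 1 - p, by omega, ?_⟩
    symm
    apply zmul h0 hA h
    have : ((B.2 - 1 - p : ℕ) : ℤ) = B.2 - 1 - p := by omega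
    rw [this]; ring
  · intro h
    apply hd
    refine ⟨p, by omega, ?_⟩
    symm
    apply zmul h0 hA h
    ring

theorem zinj {l : ℕ} {ξ : ℂ} (hξ : IsPrimitiveRoot ξ l) (h0 : ξ ≠ 0) {a : ℂ} (ha : a ≠ 0) {m n : ℤ}
    (h : a * ξ ^ m = a * ξ ^ n) : (l : ℤ) ∣ n - m := by
  have := zdiv h0 ha h _ rfl
  rw [div_self ha] at this
  exact (hξ.zpow_eq_one_iff_dvd _).1 this.symm

theorem zinj2 {l : ℕ} (hodd : Odd l) {ξ : ℂ} (hξ : IsPrimitiveRoot ξ l) (h0 : ξ ≠ 0) {a : ℂ}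
    (ha : a ≠ 0) {m n : ℤ} (k : ℤ) (hk : n - m = 2 * k)
    (h : a * ξ ^ m = a * ξ ^ n) : (l : ℤ) ∣ k := by
  have h1 := zinj hξ h0 ha h
  rw [hk] at h1
  refine IsCoprime.dvd_of_dvd_mul_left ?_ h1
  have : Nat.Coprime l 2 := hodd.coprime_two_right
  exact_mod_cast Nat.isCoprime_iff_coprime.2 this

theorem self_up {l : ℕ} (hodd : Odd l) {ξ : ℂ} (hξ : IsPrimitiveRoot ξ l) (h0 : ξ ≠ 0) {A : ℂ × ℕ}
    (hA : A.1 ≠ 0) (hr : A.2 < l) : ¬ SCov ξ A (A.1 * ξ ^ ((A.2 : ℤ) + 1)) := by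
  rintro ⟨i, hi, e⟩
  have := zinj2 hodd hξ h0 hA ((i : ℤ) + 1) (by ring) e.symm
  have := Int.le_of_dvd (by omega) this
  omega

theorem self_down {l : ℕ} (hodd : Odd l) {ξ : ℂ} (hξ : IsPrimitiveRoot ξ l) (h0 : ξ ≠ 0) {A : ℂ × ℕ}
    (hA : A.1 ≠ 0) (hr : A.2 < l) : ¬ SCov ξ A (A.1 * ξ ^ (-(A.2 : ℤ) - 1)) := by
  rintro ⟨i, hi, e⟩
  have := zinj2 hodd hξ h0 hA ((A.2 : ℤ) - i) (by ring) e
  have := Int.le_of_dvd (by omega) this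
  omega

theorem lin_root {c z : ℂ} (hz : z ≠ 0) : (1 - C c * X : ℂ[X]).eval z⁻¹ = 0 ↔ z = c := by
  simp only [eval_sub, eval_one, eval_mul, eval_C, eval_X, sub_eq_zero]
  rw [← div_eq_mul_inv, eq_div_iff hz, one_mul]

theorem qroot {ξ : ℂ} {A : ℂ × ℕ} {z : ℂ} (hz : z ≠ 0) :
    (qString ξ A.1 A.2).eval z⁻¹ = 0 ↔ SCov ξ A z := by
  unfold qString SCov
  rw [eval_prod, Finset.prod_eq_zero_iff]
  simp only [lin_root hz, Finset.mem_range]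

theorem froot {l : ℕ} {b z : ℂ} (hz : z ≠ 0) :
    (1 - C b * X ^ l : ℂ[X]).eval z⁻¹ = 0 ↔ z ^ l = b := by
  simp only [eval_sub, eval_one, eval_mul, eval_C, eval_X, eval_pow, sub_eq_zero]
  rw [inv_pow, ← div_eq_mul_inv, eq_div_iff (pow_ne_zero _ hz), one_mul]

noncomputable def QP (ξ : ℂ) (L : List (ℂ × ℕ)) : ℂ[X] := (L.map fun A => qString ξ A.1 A.2).prod

noncomputable def FP (l : ℕ) (F : List ℂ) : ℂ[X] := (F.map fun b => (1 - C b * X ^ l : ℂ[X])).prod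

theorem QP_root {ξ : ℂ} {L : List (ℂ × ℕ)} {z : ℂ} (hz : z ≠ 0) :
    (QP ξ L).eval z⁻¹ = 0 ↔ ∃ A ∈ L, SCov ξ A z := by
  unfold QP
  rw [eval_list_prod, List.prod_eq_zero_iff]
  simp [qroot hz]

theorem FP_root {l : ℕ} {F : List ℂ} {z : ℂ} (hz : z ≠ 0) :
    (FP l F).eval z⁻¹ = 0 ↔ z ^ l ∈ F := by
  unfold FP
  rw [eval_list_prod, List.prod_eq_zero_iff]
  simp only [List.map_map, List.mem_map, Function.comp, froot hz]
  simp

structure GoodL (l : ℕ) (ξ : ℂ) (L : List (ℂ × ℕ)) : Prop where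
  ne : ∀ A ∈ L, A.1 ≠ 0
  pos : ∀ A ∈ L, 0 < A.2
  lt : ∀ A ∈ L, A.2 < l
  pw : L.Pairwise (SRel ξ)

theorem GoodL.perm {l : ℕ} {ξ : ℂ} {L M : List (ℂ × ℕ)} (h : GoodL l ξ L) (hp : L.Perm M) :
    GoodL l ξ M :=
  ⟨fun A hA => h.ne A (hp.mem_iff.2 hA), fun A hA => h.pos A (hp.mem_iff.2 hA),
   fun A hA => h.lt A (hp.mem_iff.2 hA), (hp.pairwise_iff fun h => h.symm').1 h.pw⟩

theorem GoodL.tail {l : ℕ} {ξ : ℂ} {A} {L : List (ℂ × ℕ)} (h : GoodL l ξ (A :: L)) : GoodL l ξ L :=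
  ⟨fun A hA => h.ne A (by simp [hA]), fun A hA => h.pos A (by simp [hA]),
   fun A hA => h.lt A (by simp [hA]), (List.pairwise_cons.1 h.pw).2⟩

theorem QP_perm {ξ : ℂ} {L M : List (ℂ × ℕ)} (hp : L.Perm M) : QP ξ L = QP ξ M :=
  (hp.map _).prod_eq

theorem FP_perm {l : ℕ} {L M : List ℂ} (hp : L.Perm M) : FP l L = FP l M :=
  (hp.map _).prod_eq

theorem QP_cons {ξ : ℂ} {A} {L : List (ℂ × ℕ)} : QP ξ (A :: L) = qString ξ A.1 A.2 * QP ξ L := by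
  simp [QP]

theorem FP_cons {l : ℕ} {b} {L : List ℂ} : FP l (b :: L) = (1 - C b * X ^ l) * FP l L := by
  simp [FP]

theorem q_eval0 (ξ a : ℂ) (r : ℕ) : (qString ξ a r).eval 0 = 1 := by
  simp [qString, eval_prod]

theorem f_eval0 {l : ℕ} (hl : l ≠ 0) (b : ℂ) : (1 - C b * X ^ l : ℂ[X]).eval 0 = 1 := by
  simp [hl]

theorem ne_of_eval0 {f : ℂ[X]} (h : f.eval 0 = 1) : f ≠ 0 := by
  rintro rfl; simp at h

theorem good_rel {l : ℕ} (hodd : Odd l) {ξ : ℂ} (hξ : IsPrimitiveRoot ξ l) (h0 : ξ ≠ 0)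
    {L : List (ℂ × ℕ)} (h : GoodL l ξ L) {A B : ℂ × ℕ} (hA : A ∈ L) (hB : B ∈ L) :
    A = B ∨ SRel ξ A B := by
  classical
  have h2 := h.perm (List.perm_cons_erase hA)
  rw [(List.perm_cons_erase hA).mem_iff, List.mem_cons] at hB
  rcases hB with hB | hB
  · exact Or.inl hB.symm
  · exact Or.inr ((List.pairwise_cons.1 h2.pw).1 _ hB)

theorem good_up {l : ℕ} (hodd : Odd l) {ξ : ℂ} (hξ : IsPrimitiveRoot ξ l) (h0 : ξ ≠ 0)
    {L : List (ℂ × ℕ)} (h : GoodL l ξ L) {A B : ℂ × ℕ} (hA : A ∈ L) (hB : B ∈ L)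
    (hr : B.2 ≤ A.2) : ¬ SCov ξ B (A.1 * ξ ^ ((A.2 : ℤ) + 1)) := by
  rcases good_rel hodd hξ h0 h hA hB with rfl | hh
  · exact self_up hodd hξ h0 (h.ne _ hA) (h.lt _ hA)
  · exact srel_up h0 (h.ne _ hA) hh hr

theorem good_down {l : ℕ} (hodd : Odd l) {ξ : ℂ} (hξ : IsPrimitiveRoot ξ l) (h0 : ξ ≠ 0)
    {L : List (ℂ × ℕ)} (h : GoodL l ξ L) {A B : ℂ × ℕ} (hA : A ∈ L) (hB : B ∈ L)
    {i : ℕ} (hi : i < B.2) (hr : i < A.2) :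
    A.1 * ξ ^ (-(A.2 : ℤ) - 1) ≠ B.1 * ξ ^ ((B.2 : ℤ) - 1 - 2 * i) := by
  rcases good_rel hodd hξ h0 h hA hB with rfl | hh
  · intro e
    exact self_down hodd hξ h0 (h.ne _ hA) (h.lt _ hA) ⟨i, hi, e⟩
  · exact srel_down h0 (h.ne _ hA) hh hi hr

theorem list_max (L : List (ℂ × ℕ)) (P : ℂ × ℕ → Prop) (h : ∃ A ∈ L, P A) :
    ∃ A ∈ L, P A ∧ ∀ B ∈ L, P B → B.2 ≤ A.2 := by
  classical
  obtain ⟨A, hA, hP⟩ := h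
  obtain ⟨A, hA, hm⟩ := Finset.exists_max_image (L.toFinset.filter P) (fun A => A.2) ⟨A, by simp [hA, hP]⟩
  simp only [Finset.mem_filter, List.mem_toFinset] at hA hm
  exact ⟨A, hA.1, hA.2, fun B hB hP => hm B ⟨hB, hP⟩⟩

theorem zpow_l {l : ℕ} {ξ : ℂ} (hξ : IsPrimitiveRoot ξ l) (a : ℂ) (k : ℤ) :
    (a * ξ ^ k) ^ l = a ^ l := by
  rw [mul_pow, ← zpow_natCast (ξ ^ k), ← zpow_mul, mul_comm k (l : ℤ), zpow_mul, zpow_natCast, hξ.pow_eq_one]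
  simp

theorem frob_mem {l : ℕ} (hl : l ≠ 0) (hodd : Odd l) {ξ : ℂ} (hξ : IsPrimitiveRoot ξ l) (h0 : ξ ≠ 0)
    {L : List (ℂ × ℕ)} (h : GoodL l ξ L) {F : List ℂ} {b : ℂ} (hb : b ≠ 0)
    (hr : ∀ z : ℂ, z ^ l = b → (QP ξ L * FP l F).eval z⁻¹ = 0) : b ∈ F := by
  by_contra hbF
  have key : ∀ z : ℂ, z ^ l = b → ∃ A ∈ L, SCov ξ A z := by
    intro z hz
    have hz0 : z ≠ 0 := by
      rintro rfl
      rw [zero_pow hl] at hz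
      exact hb hz.symm
    have := hr z hz
    rw [eval_mul, mul_eq_zero, QP_root hz0, FP_root hz0, hz] at this
    tauto
  obtain ⟨c, hc⟩ := IsAlgClosed.exists_pow_nat_eq b (Nat.pos_of_ne_zero hl)
  have hcl : ∀ A : ℂ × ℕ, ∀ z : ℂ, z ^ l = b → SCov ξ A z → A.1 ^ l = b := by
    rintro A z hz ⟨i, hi, rfl⟩
    rwa [zpow_l hξ] at hz
  obtain ⟨A, hA, hAc⟩ := key c hc
  obtain ⟨A, hA, hP, hm⟩ := list_max L (fun A => A.1 ^ l = b) ⟨A, hA, hcl A c hc hAc⟩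
  have hy : (A.1 * ξ ^ ((A.2 : ℤ) + 1)) ^ l = b := by rw [zpow_l hξ, hP]
  obtain ⟨B, hB, hBc⟩ := key _ hy
  exact good_up hodd hξ h0 h hA hB (hm B hB (hcl B _ hy hBc)) hBc

theorem uniqL {l : ℕ} (hodd : Odd l) {ξ : ℂ} (hξ : IsPrimitiveRoot ξ l) (h0 : ξ ≠ 0) (n : ℕ) :
    ∀ L M : List (ℂ × ℕ), L.length = n → GoodL l ξ L → GoodL l ξ M → QP ξ L = QP ξ M →
      L.Perm M := by
  classical
  have z0 : ∀ (a : ℂ) (k : ℤ), a ≠ 0 → a * ξ ^ k ≠ 0 := fun a k ha =>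
    mul_ne_zero ha (zpow_ne_zero _ h0)
  induction n with
  | zero =>
    intro L M hn hL hM e
    rw [List.length_eq_zero_iff] at hn
    subst hn
    cases M with
    | nil => exact List.Perm.refl _
    | cons B M =>
      exfalso
      have hB := hM.ne B (by simp)
      have := (QP_root (ξ := ξ) (L := B :: M) (z0 B.1 ((B.2 : ℤ) - 1) hB)).2
        ⟨B, by simp, 0, hM.pos B (by simp), by simp⟩
      rw [← e] at this
      simp [QP] at this
  | succ n ih =>
    intro L M hn hL hM e
    have hne : ∃ A, A ∈ L := by
      cases L with
      | nil => simp at hn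
      | cons A L => exact ⟨A, by simp⟩
    obtain ⟨A, hA, -, hm⟩ := list_max L (fun _ => True) (by simpa using hne)
    have hA0 := hL.ne A hA
    have tr : ∀ z : ℂ, z ≠ 0 → ((∃ A ∈ L, SCov ξ A z) ↔ (∃ A ∈ M, SCov ξ A z)) := by
      intro z hz
      rw [← QP_root hz, ← QP_root hz, e]
    have hy : ∀ B ∈ M, ¬ SCov ξ B (A.1 * ξ ^ ((A.2 : ℤ) + 1)) := by
      intro B hB hc
      obtain ⟨B', hB', hc'⟩ := (tr _ (z0 _ _ hA0)).2 ⟨B, hB, hc⟩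
      exact good_up hodd hξ h0 hL hA hB' (hm _ hB' trivial) hc'
    have hx : ∀ B ∈ M, ¬ SCov ξ B (A.1 * ξ ^ (-(A.2 : ℤ) - 1)) := by
      intro B hB hc
      obtain ⟨B', hB', i, hi, hc'⟩ := (tr _ (z0 _ _ hA0)).2 ⟨B, hB, hc⟩
      exact good_down hodd hξ h0 hL hA hB' hi (lt_of_lt_of_le hi (hm _ hB' trivial)) hc'
    have hs := (tr (A.1 * ξ ^ ((A.2 : ℤ) - 1)) (z0 _ _ hA0)).1
      ⟨A, hA, 0, hL.pos A hA, by simp⟩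
    obtain ⟨B, hB, ⟨i, hi, hBs⟩, hBm⟩ := list_max M _ hs
    have hi0 : i = 0 := by
      by_contra hne
      apply hy B hB
      refine ⟨i - 1, by omega, ?_⟩
      have : ((i - 1 : ℕ) : ℤ) = i - 1 := by omega
      rw [this]
      exact zshift h0 hBs 2 _ _ (by ring) (by ring)
    subst hi0
    have hr1 : B.2 ≤ A.2 := by
      by_contra hlt
      apply hx B hB
      refine ⟨A.2, by omega, ?_⟩
      exact zshift h0 hBs (-2 * A.2) _ _ (by ring) (by push_cast; ring)
    have hr2 : A.2 ≤ B.2 := by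
      by_contra hlt
      have hz : A.1 * ξ ^ ((A.2 : ℤ) - 1 - 2 * B.2) = B.1 * ξ ^ (-(B.2 : ℤ) - 1) :=
        zshift h0 hBs (-2 * B.2) _ _ (by ring) (by push_cast; ring)
      obtain ⟨D, hD, j, hj, hDz⟩ := (tr (A.1 * ξ ^ ((A.2 : ℤ) - 1 - 2 * B.2)) (z0 _ _ hA0)).1
        ⟨A, hA, B.2, by omega, rfl⟩
      have hj2 : ¬ j < B.2 := fun hj2 =>
        good_down hodd hξ h0 hM hB hD hj hj2 (hz.symm.trans hDz)
      have : D.2 ≤ B.2 := by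
        apply hBm D hD
        refine ⟨j - B.2, by omega, ?_⟩
        have : ((j - B.2 : ℕ) : ℤ) = j - B.2 := by omega
        rw [this]
        exact zshift h0 hDz (2 * B.2) _ _ (by ring) (by ring)
      omega
    have hr : B.2 = A.2 := le_antisymm hr1 hr2
    have hAB : B = A := by
      refine Prod.ext ?_ hr
      rw [hr] at hBs
      have := zpow_ne_zero ((A.2 : ℤ) - 1) h0
      simp only [Nat.cast_zero, mul_zero, sub_zero] at hBs
      exact (mul_right_cancel₀ this hBs).symm
    subst hAB
    have pL := List.perm_cons_erase hA
    have pM := List.perm_cons_erase hB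
    rw [QP_perm pL, QP_perm pM, QP_cons, QP_cons] at e
    have e' := mul_left_cancel₀ (ne_of_eval0 (q_eval0 _ _ _)) e
    have := ih (L.erase B) (M.erase B) (by rw [List.length_erase_of_mem hA, hn]; rfl)
      (hL.perm pL).tail (hM.perm pM).tail e'
    exact pL.trans ((this.cons B).trans pM.symm)

theorem uniqLF {l : ℕ} (hl : l ≠ 0) (hodd : Odd l) {ξ : ℂ} (hξ : IsPrimitiveRoot ξ l) (h0 : ξ ≠ 0)
    (L M : List (ℂ × ℕ)) (hL : GoodL l ξ L) (hM : GoodL l ξ M) (n : ℕ) :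
    ∀ F G : List ℂ, F.length = n → (∀ b ∈ F, b ≠ 0) → (∀ b ∈ G, b ≠ 0) →
      QP ξ L * FP l F = QP ξ M * FP l G → L.Perm M ∧ F.Perm G := by
  classical
  have van : ∀ (L : List (ℂ × ℕ)) (F : List ℂ) (b : ℂ), b ∈ F → b ≠ 0 → ∀ z : ℂ, z ^ l = b →
      (QP ξ L * FP l F).eval z⁻¹ = 0 := by
    intro L F b hb hb0 z hz
    have hz0 : z ≠ 0 := by
      rintro rfl
      rw [zero_pow hl] at hz
      exact hb0 hz.symm
    rw [eval_mul, mul_eq_zero, FP_root hz0, hz]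
    exact Or.inr hb
  induction n with
  | zero =>
    intro F G hn hF hG e
    rw [List.length_eq_zero_iff] at hn
    subst hn
    cases G with
    | nil =>
      refine ⟨uniqL hodd hξ h0 _ L M rfl hL hM ?_, List.Perm.refl _⟩
      simpa [FP] using e
    | cons b G =>
      exfalso
      have hb := hG b (by simp)
      have := frob_mem hl hodd hξ h0 hL (F := []) hb (by
        rw [e]; exact van M (b :: G) b (by simp) hb)
      simp at this
  | succ n ih =>
    intro F G hn hF hG e
    cases F with
    | nil => simp at hn
    | cons b F =>
      have hb := hF b (by simp)
      have hbG : b ∈ G := frob_mem hl hodd hξ h0 hM (F := G) hb (by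
        rw [← e]; exact van L (b :: F) b (by simp) hb)
      have pG := List.perm_cons_erase hbG
      rw [FP_perm pG, FP_cons, FP_cons, mul_left_comm, mul_left_comm (QP ξ M)] at e
      have e' := mul_left_cancel₀ (ne_of_eval0 (f_eval0 hl _)) e
      obtain ⟨h1, h2⟩ := ih F (G.erase b) (by simpa using hn) (fun c hc => hF c (by simp [hc]))
        (fun c hc => hG c (List.mem_of_mem_erase hc)) e'
      exact ⟨h1, (h2.cons b).trans pG.symm⟩

theorem exists_equiv_of_perm {α : Type} {m n : ℕ} (f : Fin m → α) (g : Fin n → α)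
    (h : (List.ofFn f).Perm (List.ofFn g)) : ∃ σ : Fin m ≃ Fin n, ∀ k, f k = g (σ k) := by
  classical
  have hm : Multiset.map f Finset.univ.val = Multiset.map g Finset.univ.val := by
    rw [Fin.univ_val_map, Fin.univ_val_map]
    exact Multiset.coe_eq_coe.2 h
  have hc : ∀ c, Nonempty ({k // f k = c} ≃ {k // g k = c}) := by
    intro c
    rw [← Fintype.card_eq, Fintype.card_subtype, Fintype.card_subtype]
    have := congrArg (Multiset.count c) hm
    rw [Multiset.count_map, Multiset.count_map] at this
    simp only [eq_comm (a := c)] at this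
    exact this
  exact ⟨Equiv.ofFiberEquiv fun c => (hc c).some, fun a => (Equiv.ofFiberEquiv_map _ a).symm⟩

theorem lin_coprime {c d : ℂ} (hcd : c ≠ d) : IsCoprime (1 - C c * X : ℂ[X]) (1 - C d * X) := by
  have h : c - d ≠ 0 := sub_ne_zero.2 hcd
  refine ⟨-C (d / (c - d)), C (c / (c - d)), ?_⟩
  have e : -C (d / (c - d)) * (1 - C c * X) + C (c / (c - d)) * (1 - C d * X)
      = C (c / (c - d) - d / (c - d)) + C (d / (c - d) * c - c / (c - d) * d) * X := by
    simp only [C_sub, C_mul]; ring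
  rw [e]
  have e1 : c / (c - d) - d / (c - d) = 1 := by field_simp
  have e2 : d / (c - d) * c - c / (c - d) * d = 0 := by ring
  rw [e1, e2]; simp

theorem lin_dvd {f : ℂ[X]} {c : ℂ} (hc : c ≠ 0) (h : f.eval c⁻¹ = 0) : (1 - C c * X : ℂ[X]) ∣ f := by
  have h1 : (X - C c⁻¹ : ℂ[X]) ∣ f := dvd_iff_isRoot.2 h
  have h2 : (X - C c⁻¹ : ℂ[X]) = C (-c⁻¹) * (1 - C c * X) := by
    have : (C (-c⁻¹) * C c : ℂ[X]) = -1 := by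
      rw [← C_mul, neg_mul, inv_mul_cancel₀ hc]; simp
    rw [mul_sub, ← mul_assoc, this]; simp; ring
  rw [h2] at h1
  exact dvd_of_mul_left_dvd h1

theorem q_dvd {l : ℕ} (hodd : Odd l) {ξ : ℂ} (hξ : IsPrimitiveRoot ξ l) (h0 : ξ ≠ 0) {f : ℂ[X]}
    {A : ℂ × ℕ} (hA : A.1 ≠ 0) (hr : A.2 ≤ l) (h : ∀ z, SCov ξ A z → f.eval z⁻¹ = 0) :
    qString ξ A.1 A.2 ∣ f := by
  unfold qString
  apply Finset.prod_dvd_of_coprime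
  · intro i hi j hj hij
    apply lin_coprime
    intro e
    have := zinj2 hodd hξ h0 hA ((i : ℤ) - j) (by ring) e
    simp only [Finset.coe_range, Set.mem_Iio] at hi hj
    have := Int.eq_zero_of_abs_lt_dvd this (by rw [abs_lt]; omega)
    omega
  · intro i hi
    apply lin_dvd (mul_ne_zero hA (zpow_ne_zero _ h0))
    exact h _ ⟨i, Finset.mem_range.1 hi, rfl⟩

theorem natDegree_q {ξ : ℂ} (h0 : ξ ≠ 0) {a : ℂ} (ha : a ≠ 0) (r : ℕ) :
    (qString ξ a r).natDegree = r := by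
  unfold qString
  have hd : ∀ c : ℂ, c ≠ 0 → (1 - C c * X : ℂ[X]).natDegree = 1 := by
    intro c hc
    have : (1 - C c * X : ℂ[X]) = C (-c) * X + C 1 := by simp; ring
    rw [this]
    exact natDegree_linear (neg_ne_zero.2 hc)
  have hc : ∀ k : ℤ, a * ξ ^ k ≠ 0 := fun k => mul_ne_zero ha (zpow_ne_zero _ h0)
  rw [natDegree_prod]
  · rw [Finset.sum_congr rfl fun i _ => hd _ (hc _)]; simp
  · intro i hi e
    have := hd _ (hc ((r : ℤ) - 1 - 2 * i))
    rw [e] at this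
    simp at this

theorem natDegree_f {l : ℕ} (hl : l ≠ 0) {b : ℂ} (hb : b ≠ 0) :
    (1 - C b * X ^ l : ℂ[X]).natDegree = l := by
  have : (1 - C b * X ^ l : ℂ[X]) = C (-b) * X ^ l + C 1 := by simp; ring
  rw [this, natDegree_add_C, natDegree_C_mul_X_pow _ _ (neg_ne_zero.2 hb)]

theorem q_full {l : ℕ} (hl : l ≠ 0) (hodd : Odd l) {ξ : ℂ} (hξ : IsPrimitiveRoot ξ l) (h0 : ξ ≠ 0)
    {a : ℂ} (ha : a ≠ 0) : qString ξ a l = 1 - C (a ^ l) * X ^ l := by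
  have hb := pow_ne_zero l ha
  obtain ⟨g, hg⟩ : qString ξ a l ∣ 1 - C (a ^ l) * X ^ l := by
    apply q_dvd (A := (a, l)) hodd hξ h0 ha le_rfl
    rintro z ⟨i, hi, rfl⟩
    rw [froot (mul_ne_zero ha (zpow_ne_zero _ h0)), zpow_l hξ]
  have hq0 := ne_of_eval0 (q_eval0 ξ a l)
  have hg0 : g.eval 0 = 1 := by
    have := congrArg (eval 0) hg
    rwa [f_eval0 hl, eval_mul, q_eval0, one_mul, eq_comm] at this
  have hd := congrArg natDegree hg
  rw [natDegree_f hl hb, natDegree_mul hq0 (ne_of_eval0 hg0), natDegree_q h0 ha] at hd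
  have := eq_C_of_natDegree_eq_zero (p := g) (by omega)
  rw [this] at hg0
  simp only [eval_C] at hg0
  rw [hg, this, hg0]; simp

theorem existL {l : ℕ} (hl : 3 ≤ l) (hodd : Odd l) {ξ : ℂ} (hξ : IsPrimitiveRoot ξ l) (h0 : ξ ≠ 0)
    (n : ℕ) : ∀ f : ℂ[X], f.natDegree = n → f.eval 0 = 1 →
      ∃ (L : List (ℂ × ℕ)) (F : List ℂ), GoodL l ξ L ∧ (∀ b ∈ F, b ≠ 0) ∧ f = QP ξ L * FP l F := by
  induction n using Nat.strong_induction_on with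
  | _ n ih =>
  intro f hn hf
  have hf0 := ne_of_eval0 hf
  rcases Nat.eq_zero_or_pos n with h | hpos
  · have := eq_C_of_natDegree_eq_zero (p := f) (by omega)
    rw [this] at hf
    simp only [eval_C] at hf
    refine ⟨[], [], ⟨by simp, by simp, by simp, by simp⟩, by simp, ?_⟩
    rw [this, hf]; simp [QP, FP]
  obtain ⟨w, hw⟩ := IsAlgClosed.exists_root f (by
    rw [degree_eq_natDegree hf0, hn]; exact_mod_cast hpos.ne')
  have hw0 : w ≠ 0 := by
    rintro rfl
    rw [IsRoot.def, hf] at hw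
    exact one_ne_zero hw
  classical
  let P : ℕ → Prop := fun r => ∃ a : ℂ, a ≠ 0 ∧ ∀ z, SCov ξ (a, r) z → f.eval z⁻¹ = 0
  have hP1 : P 1 := by
    refine ⟨w⁻¹, inv_ne_zero hw0, ?_⟩
    rintro z ⟨i, hi, rfl⟩
    have : i = 0 := by simpa using hi
    subst this
    simpa using hw
  have hr1 : 1 ≤ Nat.findGreatest P l := Nat.le_findGreatest (by omega) hP1
  have hrl : Nat.findGreatest P l ≤ l := Nat.findGreatest_le l
  have hPr : P (Nat.findGreatest P l) := Nat.findGreatest_spec (by omega : 1 ≤ l) hP1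
  have hmax : ∀ k, Nat.findGreatest P l < k → k ≤ l → ¬ P k := fun k h1 h2 =>
    Nat.findGreatest_is_greatest h1 h2
  generalize Nat.findGreatest P l = r at hr1 hrl hPr hmax
  obtain ⟨a, ha, hroot⟩ := hPr
  obtain ⟨g, hg⟩ := q_dvd (A := (a, r)) hodd hξ h0 ha hrl hroot
  simp only at hg
  have hg1 : g.eval 0 = 1 := by
    have := congrArg (eval 0) hg
    rwa [hf, eval_mul, q_eval0, one_mul, eq_comm] at this
  have hd := congrArg natDegree hg
  rw [natDegree_mul (ne_of_eval0 (q_eval0 _ _ _)) (ne_of_eval0 hg1), natDegree_q h0 ha] at hd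
  obtain ⟨L, F, hL, hF, hgL⟩ := ih g.natDegree (by omega) g rfl hg1
  rcases hrl.eq_or_lt with rfl | hlt
  · refine ⟨L, a ^ r :: F, hL, ?_, ?_⟩
    · intro b hb
      rcases List.mem_cons.1 hb with rfl | hb
      · exact pow_ne_zero _ ha
      · exact hF b hb
    · rw [hg, hgL, q_full (by omega) hodd hξ h0 ha, FP_cons]; ring
  · have hvan : ∀ B ∈ L, ∀ z, z ≠ 0 → SCov ξ B z → f.eval z⁻¹ = 0 := by
      intro B hB z hz hc
      rw [hg, hgL, eval_mul, eval_mul, (QP_root hz).2 ⟨B, hB, hc⟩]; simp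
    refine ⟨(a, r) :: L, F, ⟨?_, ?_, ?_, ?_⟩, hF, ?_⟩
    · intro B hB
      rcases List.mem_cons.1 hB with rfl | hB
      · exact ha
      · exact hL.ne B hB
    · intro B hB
      rcases List.mem_cons.1 hB with rfl | hB
      · exact hr1
      · exact hL.pos B hB
    · intro B hB
      rcases List.mem_cons.1 hB with rfl | hB
      · exact hlt
      · exact hL.lt B hB
    · refine List.pairwise_cons.2 ⟨?_, hL.pw⟩
      intro B hB
      apply srel_of h0 (A := (a, r)) ha
      · intro hc
        have hv := hvan B hB _ (mul_ne_zero ha (zpow_ne_zero _ h0)) hc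
        apply hmax (r + 1) (by omega) (by omega)
        refine ⟨a * ξ ^ (1 : ℤ), mul_ne_zero ha (zpow_ne_zero _ h0), ?_⟩
        rintro z ⟨i, hi, rfl⟩
        simp only at hi ⊢
        rw [mul_assoc, ← zpow_add₀ h0]
        rcases Nat.eq_zero_or_pos i with rfl | hi0
        · convert hv using 4
          push_cast; ring
        · apply hroot
          refine ⟨i - 1, by simp only; omega, ?_⟩
          have : ((i - 1 : ℕ) : ℤ) = i - 1 := by omega
          rw [this]
          congr 2
          push_cast; ring
      · intro hc
        have hv := hvan B hB _ (mul_ne_zero ha (zpow_ne_zero _ h0)) hc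
        apply hmax (r + 1) (by omega) (by omega)
        refine ⟨a * ξ ^ (-1 : ℤ), mul_ne_zero ha (zpow_ne_zero _ h0), ?_⟩
        rintro z ⟨i, hi, rfl⟩
        simp only at hi ⊢
        rw [mul_assoc, ← zpow_add₀ h0]
        rcases Nat.lt_or_ge i r with hi0 | hi0
        · apply hroot
          refine ⟨i, hi0, ?_⟩
          congr 2
          push_cast; ring
        · have : i = r := by omega
          subst this
          convert hv using 4
          push_cast; ring
    · rw [hg, hgL, QP_cons]; ring

theorem good_ofFn {l : ℕ} {ξ : ℂ} {m : ℕ} (a : Fin m → ℂ) (r : Fin m → ℕ) (ha : ∀ k, a k ≠ 0)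
    (hr : ∀ k, 0 < r k ∧ r k < l) (h : NonResonant ξ a r) :
    GoodL l ξ (List.ofFn fun k => (a k, r k)) := by
  refine ⟨?_, ?_, ?_, ?_⟩
  · intro A hA
    obtain ⟨k, rfl⟩ := (List.mem_ofFn' _ _).1 hA
    exact ha k
  · intro A hA
    obtain ⟨k, rfl⟩ := (List.mem_ofFn' _ _).1 hA
    exact (hr k).1
  · intro A hA
    obtain ⟨k, rfl⟩ := (List.mem_ofFn' _ _).1 hA
    exact (hr k).2
  · rw [List.pairwise_ofFn]
    intro i j hij
    exact h i j hij.ne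

theorem QP_ofFn {ξ : ℂ} {m : ℕ} (a : Fin m → ℂ) (r : Fin m → ℕ) :
    QP ξ (List.ofFn fun k => (a k, r k)) = ∏ k, qString ξ (a k) (r k) := by
  unfold QP
  rw [List.map_ofFn, List.prod_ofFn]; rfl

theorem FP_ofFn {l : ℕ} {m : ℕ} (b : Fin m → ℂ) :
    FP l (List.ofFn b) = ∏ k, (1 - C (b k) * X ^ l) := by
  unfold FP
  rw [List.map_ofFn, List.prod_ofFn]; rfl

/-- Let `l ≥ 3` be odd and `ξ` a primitive `l`-th root of unity. Every `f ∈ ℂ[u]` with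
`f(0) = 1` admits a factorization
`f = (∏_{k} f_{a_k, r_k}) · (∏_{k} (1 - b_k u^l))` with `a_k, b_k ∈ ℂ^×`, `0 < r_k < l`,
satisfying the non-resonance condition on the quantum factors, and this `ξ`-factorization is
unique up to permutation of the factors within each product. -/
theorem stmt8 (l : ℕ) (hl3 : 3 ≤ l) (hodd : Odd l) (ξ : ℂ) (hξ : IsPrimitiveRoot ξ l)
    (f : Polynomial ℂ) (hf : f.eval 0 = 1) :
    ∃ (m₀ m₁ : ℕ) (a : Fin m₀ → ℂ) (r : Fin m₀ → ℕ) (b : Fin m₁ → ℂ),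
      (∀ k, a k ≠ 0) ∧ (∀ k, 0 < r k ∧ r k < l) ∧ (∀ k, b k ≠ 0) ∧
      f = (∏ k, qString ξ (a k) (r k)) * ∏ k, (1 - C (b k) * X ^ l) ∧
      NonResonant ξ a r ∧
      ∀ (m₀' m₁' : ℕ) (a' : Fin m₀' → ℂ) (r' : Fin m₀' → ℕ) (b' : Fin m₁' → ℂ),
        (∀ k, a' k ≠ 0) → (∀ k, 0 < r' k ∧ r' k < l) → (∀ k, b' k ≠ 0) →
        f = (∏ k, qString ξ (a' k) (r' k)) * ∏ k, (1 - C (b' k) * X ^ l) →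
        NonResonant ξ a' r' →
        ∃ (σ : Fin m₀' ≃ Fin m₀) (τ : Fin m₁' ≃ Fin m₁),
          (∀ k, a' k = a (σ k)) ∧ (∀ k, r' k = r (σ k)) ∧ ∀ k, b' k = b (τ k) := by
  have hl0 : l ≠ 0 := by omega
  have h0 : ξ ≠ 0 := hξ.ne_zero hl0
  obtain ⟨L, F, hL, hF, hfL⟩ := existL hl3 hodd hξ h0 _ f rfl hf
  have eL : (List.ofFn fun k : Fin L.length => ((L.get k).1, (L.get k).2)) = L := List.ofFn_get L
  have eF : List.ofFn F.get = F := List.ofFn_get F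
  refine ⟨L.length, F.length, fun k => (L.get k).1, fun k => (L.get k).2, F.get,
    fun k => hL.ne _ (L.get_mem k), fun k => ⟨hL.pos _ (L.get_mem k), hL.lt _ (L.get_mem k)⟩,
    fun k => hF _ (F.get_mem k), ?_, ?_, ?_⟩
  · rw [← QP_ofFn, ← FP_ofFn, eL, eF, hfL]
  · have hp := List.pairwise_iff_get.1 hL.pw
    intro k j hkj
    rcases lt_or_gt_of_ne hkj with h | h
    · exact hp k j h
    · exact (hp j k h).symm'
  · intro m₀' m₁' a' r' b' ha' hr' hb' hf' hnr'
    have hG := good_ofFn a' r' ha' hr' hnr'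
    rw [← QP_ofFn, ← FP_ofFn, hfL] at hf'
    obtain ⟨p1, p2⟩ := uniqLF hl0 hodd hξ h0 _ _ hG hL _ (List.ofFn b') F rfl (by
      intro b hb
      obtain ⟨k, rfl⟩ := (List.mem_ofFn' _ _).1 hb
      exact hb' k) hF hf'.symm
    rw [← eL] at p1
    rw [← eF] at p2
    obtain ⟨σ, hσ⟩ := exists_equiv_of_perm _ _ p1
    obtain ⟨τ, hτ⟩ := exists_equiv_of_perm _ _ p2
    exact ⟨σ, τ, fun k => congrArg Prod.fst (hσ k), fun k => congrArg Prod.snd (hσ k), hτ⟩
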